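/- Let g, h ∈ ℝ[x,y] be coprime polynomials of degrees d and e, respectively. Then the set of common real zeros {p ∈ ℝ² : g(p) = 0 and h(p) = 0} is finite and has at most d·e elements. -/

import Mathlib

open MvPolynomial in
/-- The space of bivariate polynomials of total degree at most `m` has dimension
`(m + 1) * (m + 2) / 2`. -/
theorem two_mul_finrank_restrictTotalDegree_fin_two (K : Type*) [Field K] (m : ℕ) :
    2 * Module.finrank K (restrictTotalDegree (Fin 2) K m) = (m + 1) * (m + 2) := by
  have e : {n : Fin 2 →₀ ℕ | (n.sum fun _ e => e) ≤ m} ≃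
      (Finset.range (m + 1)).sigma (fun s => Finset.HasAntidiagonal.antidiagonal s) :=
    { toFun := fun n => ⟨⟨n.1 0 + n.1 1, (n.1 0, n.1 1)⟩, by
        have h := n.2
        simp only [Set.mem_ofPred_eq, Finsupp.sum_fintype, Fin.sum_univ_two, implies_true] at h
        simpa [Nat.lt_succ_iff] using h⟩
      invFun := fun x => ⟨Finsupp.equivFunOnFinite.symm ![x.1.2.1, x.1.2.2], by
        have h := x.2
        simp only [Finset.mem_sigma, Finset.mem_range, Finset.HasAntidiagonal.mem_antidiagonal] at h
        simp only [Set.mem_ofPred_eq, Finsupp.sum_fintype, Fin.sum_univ_two, implies_true]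
        simp
        lia⟩
      left_inv := fun n => by
        ext i
        fin_cases i <;> simp
      right_inv := fun x => by
        obtain ⟨⟨s, i, j⟩, h⟩ := x
        simp only [Finset.mem_sigma, Finset.mem_range, Finset.HasAntidiagonal.mem_antidiagonal] at h
        obtain ⟨_, rfl⟩ := h
        simp }
  have hcard : Module.finrank K (restrictTotalDegree (Fin 2) K m) =
      ∑ s ∈ Finset.range (m + 1), (s + 1) := by
    refine (Module.finrank_eq_nat_card_basis (basisRestrictSupport K _)).trans ?_
    rw [Nat.card_congr e, Nat.card_eq_fintype_card, Fintype.card_coe, Finset.card_sigma]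
    simp
  rw [hcard]
  clear hcard e
  induction m with
  | zero => simp
  | succ m ih => rw [Finset.sum_range_succ, mul_add, ih]; ring

open MvPolynomial in
/-- A finite set of points admits, at each of its points, a polynomial which is nonzero there and
vanishes at all the other points. -/
theorem MvPolynomial.exists_eval_ne_zero_and_eval_eq_zero {σ K : Type*} [Field K]
    (S : Finset (σ → K)) (p : σ → K) :
    ∃ f : MvPolynomial σ K, eval p f ≠ 0 ∧ ∀ q ∈ S, q ≠ p → eval q f = 0 := by
  classical
  have hsep : ∀ q : σ → K, ∃ f : MvPolynomial σ K, q ≠ p → eval p f ≠ 0 ∧ eval q f = 0 := by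
    intro q
    by_cases hq : q = p
    · exact ⟨0, fun h => absurd hq h⟩
    · obtain ⟨i, hi⟩ := Function.ne_iff.mp hq
      exact ⟨X i - C (q i), fun _ => ⟨by simpa [sub_eq_zero] using hi.symm, by simp⟩⟩
  choose f hf using hsep
  refine ⟨∏ q ∈ S.erase p, f q, ?_, fun q hq hqp => ?_⟩
  · rw [eval_prod]
    exact Finset.prod_ne_zero_iff.mpr fun q hq => (hf q (Finset.ne_of_mem_erase hq)).1
  · rw [eval_prod]
    exact Finset.prod_eq_zero (Finset.mem_erase.mpr ⟨hqp, hq⟩) (hf q hqp).2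

open MvPolynomial in
/-- Evaluation at finitely many points is onto from the polynomials of sufficiently large
total degree. -/
theorem MvPolynomial.exists_forall_ge_surjective_eval {σ K : Type*} [Field K]
    (S : Finset (σ → K)) :
    ∃ m₀ : ℕ, ∀ m ≥ m₀, ∀ v : S → K, ∃ f ∈ restrictTotalDegree σ K m,
      ∀ p : S, eval p.1 f = v p := by
  classical
  choose f hf₀ hf using fun p : σ → K => exists_eval_ne_zero_and_eval_eq_zero S p
  refine ⟨S.attach.sup fun p => (f p.1).totalDegree, fun m hm v =>
    ⟨∑ p : S, (v p / eval p.1 (f p.1)) • f p.1, ?_, fun p => ?_⟩⟩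
  · refine Submodule.sum_mem _ fun p _ => Submodule.smul_mem _ _ ?_
    rw [mem_restrictTotalDegree]
    exact (Finset.le_sup (f := fun p : S => (f p.1).totalDegree) (Finset.mem_attach S p)).trans hm
  · rw [map_sum, Finset.sum_eq_single p]
    · rw [smul_eval, div_mul_cancel₀ _ (hf₀ p.1)]
    · intro q _ hqp
      rw [smul_eval, hf q.1 p.1 p.2 fun h => hqp (Subtype.ext h.symm), mul_zero]
    · simp

open MvPolynomial in
/-- A bounded-degree common multiple of two coprime polynomials is a bounded-degree multiple of
their product. -/
theorem MvPolynomial.exists_eq_mul_mul_of_mul_eq_mul {σ K : Type*} [Field K]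
    {g h a b : MvPolynomial σ K} (hgh : IsRelPrime g h) (hg : g ≠ 0) {m : ℕ}
    (hb : b.totalDegree ≤ m + g.totalDegree) (hab : a * g = b * h) :
    ∃ c ∈ restrictTotalDegree σ K m, c * (g * h) = b * h := by
  obtain ⟨c, rfl⟩ : g ∣ b := hgh.dvd_of_dvd_mul_right ⟨a, by rw [← hab, mul_comm]⟩
  refine ⟨c, ?_, by ring⟩
  rw [mem_restrictTotalDegree]
  rcases eq_or_ne c 0 with rfl | hc
  · simp
  · rw [totalDegree_mul_of_isDomain hg hc] at hb
    lia

open MvPolynomial in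
theorem MvPolynomial.map_mulRight_restrictTotalDegree_le {σ K : Type*} [Field K]
    (g : MvPolynomial σ K) {m n : ℕ} (hmn : m + g.totalDegree ≤ n) :
    (restrictTotalDegree σ K m).map (LinearMap.mulRight K g) ≤ restrictTotalDegree σ K n := by
  rintro _ ⟨a, ha, rfl⟩
  rw [SetLike.mem_coe, mem_restrictTotalDegree] at ha
  rw [mem_restrictTotalDegree, LinearMap.mulRight_apply]
  exact (totalDegree_mul a g).trans (by lia)

open MvPolynomial in
/-- Two coprime bivariate polynomials span, in sufficiently large degree, a subspace whose
codimension is at most the product of their degrees. -/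
theorem finrank_restrictTotalDegree_le_of_isRelPrime {K : Type*} [Field K]
    {g h : MvPolynomial (Fin 2) K} (hgh : IsRelPrime g h) (hg : g ≠ 0) (hh : h ≠ 0) (m : ℕ) :
    Module.finrank K (restrictTotalDegree (Fin 2) K (m + g.totalDegree + h.totalDegree)) ≤
      Module.finrank K
        ((restrictTotalDegree (Fin 2) K (m + h.totalDegree)).map (LinearMap.mulRight K g) ⊔
          (restrictTotalDegree (Fin 2) K (m + g.totalDegree)).map (LinearMap.mulRight K h) :
          Submodule K (MvPolynomial (Fin 2) K)) + g.totalDegree * h.totalDegree := by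
  have hfin : ∀ {f : MvPolynomial (Fin 2) K} (n : ℕ), f ≠ 0 → Module.finrank K
      ((restrictTotalDegree (Fin 2) K n).map (LinearMap.mulRight K f)) =
      Module.finrank K (restrictTotalDegree (Fin 2) K n) := fun n hf =>
    (Submodule.equivMapOfInjective (LinearMap.mulRight K _)
      (fun _ _ hab => mul_right_cancel₀ hf hab) _).symm.finrank_eq
  have hinf : (restrictTotalDegree (Fin 2) K (m + h.totalDegree)).map (LinearMap.mulRight K g) ⊓
      (restrictTotalDegree (Fin 2) K (m + g.totalDegree)).map (LinearMap.mulRight K h) ≤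
      (restrictTotalDegree (Fin 2) K m).map (LinearMap.mulRight K (g * h)) := by
    rintro _ ⟨⟨a, -, rfl⟩, ⟨b, hb, hab⟩⟩
    obtain ⟨c, hc, hcb⟩ := exists_eq_mul_mul_of_mul_eq_mul hgh hg
      ((mem_restrictTotalDegree _ _ _).mp hb) hab.symm
    exact ⟨c, hc, hcb.trans hab⟩
  have h1 := Submodule.finrank_mono hinf
  have h2 := Submodule.finrank_sup_add_finrank_inf_eq
    ((restrictTotalDegree (Fin 2) K (m + h.totalDegree)).map (LinearMap.mulRight K g))
    ((restrictTotalDegree (Fin 2) K (m + g.totalDegree)).map (LinearMap.mulRight K h))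
  rw [hfin _ (mul_ne_zero hg hh)] at h1
  rw [hfin _ hg, hfin _ hh] at h2
  have d1 := two_mul_finrank_restrictTotalDegree_fin_two K m
  have d2 := two_mul_finrank_restrictTotalDegree_fin_two K (m + g.totalDegree)
  have d3 := two_mul_finrank_restrictTotalDegree_fin_two K (m + h.totalDegree)
  have d4 := two_mul_finrank_restrictTotalDegree_fin_two K (m + g.totalDegree + h.totalDegree)
  linarith

/-- If a linear map is onto from `V` and vanishes on `W ≤ V`, the dimension of its target is at most
the codimension of `W` in `V`. -/
theorem Submodule.finrank_add_finrank_le_of_map_eq_top {K E F : Type*} [Field K]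
    [AddCommGroup E] [Module K E] [AddCommGroup F] [Module K F] (f : E →ₗ[K] F)
    {V W : Submodule K E} [FiniteDimensional K V] (hV : V.map f = ⊤) (hWV : W ≤ V)
    (hW : W ≤ LinearMap.ker f) :
    Module.finrank K F + Module.finrank K W ≤ Module.finrank K V := by
  have h1 := (f.domRestrict V).finrank_range_add_finrank_ker
  rw [LinearMap.range_domRestrict, hV, finrank_top] at h1
  have hker : W ≤ (LinearMap.ker (f.domRestrict V)).map V.subtype := fun x hx =>
    ⟨⟨x, hWV hx⟩, LinearMap.mem_ker.mpr (LinearMap.mem_ker.mp (hW hx)), rfl⟩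
  have h2 := (Submodule.finrank_mono hker).trans (Submodule.finrank_map_le _ _)
  lia

open MvPolynomial in
/-- Any finite set of common zeros of two coprime nonzero bivariate polynomials has at most as many
elements as the product of their degrees. -/
theorem card_le_mul_totalDegree_of_isRelPrime {K : Type*} [Field K]
    {g h : MvPolynomial (Fin 2) K} (hgh : IsRelPrime g h) (hg : g ≠ 0) (hh : h ≠ 0)
    (S : Finset (Fin 2 → K)) (hS : ∀ p ∈ S, eval p g = 0 ∧ eval p h = 0) :
    S.card ≤ g.totalDegree * h.totalDegree := by
  obtain ⟨m, hm⟩ := exists_forall_ge_surjective_eval S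
  obtain ⟨ev, ev_apply⟩ : ∃ ev : MvPolynomial (Fin 2) K →ₗ[K] (S → K),
      ∀ f p, ev f p = eval p.1 f :=
    ⟨LinearMap.pi fun p : S => (aeval p.1).toLinearMap, fun f p => by simp [aeval_eq_eval]⟩
  have hev : (restrictTotalDegree (Fin 2) K (m + g.totalDegree + h.totalDegree)).map ev = ⊤ := by
    refine eq_top_iff.mpr fun v _ => ?_
    obtain ⟨f, hf, hfv⟩ := hm (m + g.totalDegree + h.totalDegree) (by lia) v
    refine ⟨f, hf, funext fun p => ?_⟩
    rw [ev_apply, hfv]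
  have hcodim := Submodule.finrank_add_finrank_le_of_map_eq_top ev hev
    (sup_le (map_mulRight_restrictTotalDegree_le (m := m + h.totalDegree) g (by lia))
      (map_mulRight_restrictTotalDegree_le (m := m + g.totalDegree) h le_rfl)) <| by
    refine sup_le ?_ ?_ <;> rintro _ ⟨a, -, rfl⟩ <;>
      refine LinearMap.mem_ker.mpr (funext fun p => ?_) <;>
      simp [ev_apply, hS p.1 p.2]
  rw [Module.finrank_fintype_fun_eq_card, Fintype.card_coe] at hcodim
  have hle := finrank_restrictTotalDegree_le_of_isRelPrime hgh hg hh m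
  exact Nat.add_le_add_iff_left.mp ((Nat.add_comm _ _).trans_le (hcodim.trans hle))

/-- **real Bézout bound for plane curves.** Let `g, h ∈ ℝ[x,y]` be
coprime polynomials (no common nonunit divisor) of degrees `d` and `e`. Then their set of
common real zeros is finite, with at most `d·e` elements. -/
theorem bezout_real_plane_curves
    (g h : MvPolynomial (Fin 2) ℝ) (d e : ℕ)
    (hd : g.totalDegree = d) (he : h.totalDegree = e)
    (hcop : ∀ p : MvPolynomial (Fin 2) ℝ, p ∣ g → p ∣ h → IsUnit p) :
    ({p : Fin 2 → ℝ | MvPolynomial.eval p g = 0 ∧ MvPolynomial.eval p h = 0}).Finite ∧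
    ({p : Fin 2 → ℝ | MvPolynomial.eval p g = 0 ∧ MvPolynomial.eval p h = 0}).ncard
      ≤ d * e := by
  subst hd he
  have hbound : ∀ S : Finset (Fin 2 → ℝ),
      (∀ p ∈ S, MvPolynomial.eval p g = 0 ∧ MvPolynomial.eval p h = 0) →
      S.card ≤ g.totalDegree * h.totalDegree := by
    intro S hS
    by_cases hne : g ≠ 0 ∧ h ≠ 0
    · exact card_le_mul_totalDegree_of_isRelPrime (fun p => hcop p) hne.1 hne.2 S hS
    · suffices S = ∅ by simp [this]
      refine Finset.eq_empty_of_forall_notMem fun p hp => ?_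
      rcases eq_or_ne g 0 with rfl | hg
      · exact ((hcop h (dvd_zero h) dvd_rfl).map (MvPolynomial.eval p)).ne_zero (hS p hp).2
      · obtain rfl : h = 0 := by tauto
        exact ((hcop g dvd_rfl (dvd_zero g)).map (MvPolynomial.eval p)).ne_zero (hS p hp).1
  have hfin : {p : Fin 2 → ℝ | MvPolynomial.eval p g = 0 ∧
      MvPolynomial.eval p h = 0}.Finite := by
    by_contra hinf
    obtain ⟨S, hS, hcard⟩ := Set.Infinite.exists_subset_card_eq hinf
      (g.totalDegree * h.totalDegree + 1)
    have := hbound S fun p hp => hS hp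
    lia
  refine ⟨hfin, ?_⟩
  rw [Set.ncard_eq_toFinset_card _ hfin]
  exact hbound _ fun p hp => hfin.mem_toFinset.mp hp
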